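/- arXiv:2201.13307 — 6 statements merged into one kernel-verified Lean document; each statement's English description precedes it below -/
import Mathlib

section
/- Let 𝓐 be an abelian category, δ : 𝓐 ⥤ 𝓐 an additive functor preserving epimorphisms, and η : δ ⟶ 𝟭 a natural transformation. Then for every object F of 𝓐, the object F^η := coker(η_F : δF → F) satisfies η_{F^η} = 0; that is, the cokernel of η_F always lies in the full subcategory 𝓐^η of objects on which η vanishes. -/
open CategoryTheory CategoryTheory.Limits

universe v u

/-- For an abelian category `A`, an additive endofunctor `δ` preserving epimorphisms and a
natural transformation `η : δ ⟶ 𝟭 A`, the cokernel `F^η` of `η_F : δ F ⟶ F` satisfies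
`η_{F^η} = 0`, i.e. it lies in the full subcategory `A^η` of objects on which `η` vanishes. -/
theorem coker_eta_mem_eta_vanishing
    {A : Type u} [Category.{v} A] [Abelian A]
    (δ : A ⥤ A) [δ.Additive] [δ.PreservesEpimorphisms]
    (η : δ ⟶ 𝟭 A) (F : A) :
    η.app (cokernel (η.app F)) = 0 := by
  let p : F ⟶ cokernel (η.app F) := cokernel.π (η.app F)
  haveI : Epi p := inferInstanceAs (Epi (cokernel.π (η.app F)))
  have h : δ.map p ≫ η.app (cokernel (η.app F)) = η.app F ≫ p := η.naturality p
  have h0 : η.app F ≫ p = 0 := cokernel.condition (η.app F)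
  rw [h0] at h
  exact (cancel_epi (δ.map p)).1 (h.trans comp_zero.symm)
end

section
/- Let 𝓐 be an abelian category, δ : 𝓐 ⥤ 𝓐 an exact functor, and η : δ ⟶ 𝟭 a natural transformation. Let 0 → F₁ →^f F₂ →^g F₃ → 0 be a short exact sequence in 𝓐 with η_{F₁} = 0 and η_{F₃} = 0. Then there is a unique morphism h : δF₃ → F₁ such that η_{F₂} = f ∘ h ∘ δ(g); in particular η_{F₂} = 0 if and only if h = 0. -/
open CategoryTheory CategoryTheory.Limits

universe v u

/-- Let `A` be abelian, `δ : A ⥤ A` exact, `η : δ ⟶ 𝟭`.  For a short exact sequence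
`0 → F₁ →f F₂ →g F₃ → 0` with `η_{F₁} = 0` and `η_{F₃} = 0`, there is a unique morphism
`h : δ F₃ ⟶ F₁` with `η_{F₂} = δ(g) ≫ h ≫ f`; in particular `η_{F₂} = 0 ↔ h = 0`. -/
theorem eta_factorization_of_shortExact
    {A : Type u} [Category.{v} A] [Abelian A]
    (δ : A ⥤ A) [PreservesFiniteLimits δ] [PreservesFiniteColimits δ]
    (η : δ ⟶ 𝟭 A)
    (F₁ F₂ F₃ : A) (f : F₁ ⟶ F₂) (g : F₂ ⟶ F₃) (w : f ≫ g = 0)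
    (hse : (ShortComplex.mk f g w).ShortExact)
    (h₁ : η.app F₁ = 0) (h₃ : η.app F₃ = 0) :
    ∃! h : δ.obj F₃ ⟶ F₁,
      η.app F₂ = δ.map g ≫ h ≫ f ∧ (η.app F₂ = 0 ↔ h = 0) := by
  have : δ.Additive := Functor.additive_of_preserves_binary_products δ
  have hδ := hse.map_of_exact δ
  have : Mono f := hse.mono_f
  have := hδ.epi_g
  have : Epi (δ.map g) := hδ.epi_g
  obtain ⟨e, he⟩ : ∃ e : δ.obj F₂ ⟶ F₂, e = η.app F₂ := ⟨_, rfl⟩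
  have n₁ : δ.map f ≫ e = 0 := by
    have := η.naturality f
    rw [h₁, zero_comp] at this
    rw [he]
    exact this
  have n₃ : e ≫ g = 0 := by
    have := η.naturality g
    rw [h₃, comp_zero] at this
    rw [he]
    exact this.symm
  have key : ∃ h : δ.obj F₃ ⟶ F₁, e = δ.map g ≫ h ≫ f := by
    obtain ⟨k, hk⟩ : ∃ k : δ.obj F₂ ⟶ F₁, k ≫ f = e :=
      ⟨hse.exact.lift e n₃, hse.exact.lift_f e n₃⟩
    have hk0 : δ.map f ≫ k = 0 := by
      rw [← cancel_mono f, Category.assoc, hk, n₁, zero_comp]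
    obtain ⟨h, hh⟩ : ∃ h : δ.obj F₃ ⟶ F₁, δ.map g ≫ h = k :=
      ⟨hδ.exact.desc k hk0, hδ.exact.g_desc k hk0⟩
    exact ⟨h, by rw [← Category.assoc, hh, hk]⟩
  have uniq : ∀ h h' : δ.obj F₃ ⟶ F₁, δ.map g ≫ h ≫ f = δ.map g ≫ h' ≫ f → h = h' := by
    intro h h' hh
    rwa [cancel_epi, cancel_mono] at hh
  obtain ⟨h, hh⟩ := key
  have goal : ∃! h : δ.obj F₃ ⟶ F₁, e = δ.map g ≫ h ≫ f ∧ (e = 0 ↔ h = 0) := by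
    refine ⟨h, ⟨hh, fun h0 => ?_, fun h0 => ?_⟩, fun h' hh' => ?_⟩
    · apply uniq
      rw [← hh, h0]
      simp
    · rw [hh, h0]
      simp
    · exact uniq _ _ (hh'.1.symm.trans hh)
  subst he
  exact goal
end

section
/- Let 𝓐 be an abelian category, δ : 𝓐 ⥤ 𝓐 an exact functor, and η : δ ⟶ 𝟭 a natural transformation. Then: (i) if P is a projective object of 𝓐, then P^η := coker(η_P) is a projective object of the full subcategory 𝓐^η = {G : η_G = 0} (i.e., Hom(P^η, −) restricted to 𝓐^η sends epimorphisms to surjections); (ii) if 𝓐 has enough projectives, then 𝓐^η has enough projectives: every object F with η_F = 0 admits an epimorphism Q → F where η_Q = 0 and Q is projective in 𝓐^η. -/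
open CategoryTheory CategoryTheory.Limits

universe v u

/-- `P` is a projective object of the full subcategory `A^η = {G : η_G = 0}`:
the restriction of `Hom(P, −)` to `A^η` sends epimorphisms to surjections. -/
def ProjectiveInEtaVanishing {A : Type u} [Category.{v} A] [Abelian A]
    (δ : A ⥤ A) (η : δ ⟶ 𝟭 A) (P : A) : Prop :=
  ∀ (G G' : A) (e : G ⟶ G'), Epi e → η.app G = 0 → η.app G' = 0 →
    ∀ φ : P ⟶ G', ∃ ψ : P ⟶ G, ψ ≫ e = φ

/-- Let `A` be abelian, `δ : A ⥤ A` exact, `η : δ ⟶ 𝟭`.  (i) If `P` is projective in `A`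
then `P^η := coker (η_P)` is a projective object of `A^η`; (ii) if `A` has enough
projectives, so does `A^η`: every `F` with `η_F = 0` receives an epimorphism from an
object of `A^η` which is projective in `A^η`. -/
theorem coker_eta_projective_and_enoughProjectives
    {A : Type u} [Category.{v} A] [Abelian A]
    (δ : A ⥤ A) [PreservesFiniteLimits δ] [PreservesFiniteColimits δ]
    (η : δ ⟶ 𝟭 A) :
    (∀ P : A, Projective P →
      η.app (cokernel (η.app P)) = 0 ∧
        ProjectiveInEtaVanishing δ η (cokernel (η.app P))) ∧
    (EnoughProjectives A → ∀ F : A, η.app F = 0 →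
      ∃ (Q : A) (p : Q ⟶ F), η.app Q = 0 ∧ Epi p ∧ ProjectiveInEtaVanishing δ η Q) := by
  have hi : ∀ P : A, Projective P →
      η.app (cokernel (η.app P)) = 0 ∧
        ProjectiveInEtaVanishing δ η (cokernel (η.app P)) := by
    intro P hP
    refine ⟨?_, ?_⟩
    · rw [← cancel_epi (δ.map (cokernel.π (η.app P)))]
      have h := η.naturality (cokernel.π (η.app P))
      rw [h, comp_zero]
      exact cokernel.condition (η.app P)
    · intro G G' e he hG hG' φ
      have hl : Projective.factorThru (cokernel.π (η.app P) ≫ φ) e ≫ e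
          = cokernel.π (η.app P) ≫ φ := Projective.factorThru_comp _ _
      generalize Projective.factorThru (cokernel.π (η.app P) ≫ φ) e = l at hl
      have hz : η.app P ≫ l = 0 := by
        have h := η.naturality l
        rw [hG, comp_zero] at h
        exact h.symm
      refine ⟨cokernel.desc (η.app P) l hz, ?_⟩
      apply (cancel_epi (cokernel.π (η.app P))).1
      rw [cokernel.π_desc_assoc]
      exact hl
  refine ⟨hi, ?_⟩
  intro hE F hF
  have hz : η.app (Projective.over F) ≫ Projective.π F = 0 := by
    have h := η.naturality (Projective.π F)
    rw [hF, comp_zero] at h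
    exact h.symm
  obtain ⟨h1, h2⟩ := hi (Projective.over F) inferInstance
  refine ⟨cokernel (η.app (Projective.over F)), cokernel.desc _ (Projective.π F) hz, h1, ?_, h2⟩
  have : Epi (cokernel.π (η.app (Projective.over F)) ≫ cokernel.desc _ (Projective.π F) hz) := by
    rw [cokernel.π_desc]
    infer_instance
  exact epi_of_epi (cokernel.π (η.app (Projective.over F))) _
end

section
/- Let 𝓐 be an abelian category, δ : 𝓐 ⥤ 𝓐 an exact functor, and η : δ ⟶ 𝟭 a natural transformation; set κF := ker(η_F : δF → F). Suppose F is an object of 𝓐 such that η_{κF} = 0. Then for every monomorphism K → F, one also has η_{κK} = 0. -/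
open CategoryTheory CategoryTheory.Limits

universe v u

/-- Let `A` be abelian, `δ : A ⥤ A` exact, `η : δ ⟶ 𝟭`, and set `κF := ker (η_F)`.
If `η_{κF} = 0` then for every subobject `K ↪ F` one also has `η_{κK} = 0`. -/
theorem eta_kernel_vanishing_of_subobject
    {A : Type u} [Category.{v} A] [Abelian A]
    (δ : A ⥤ A) [PreservesFiniteLimits δ] [PreservesFiniteColimits δ]
    (η : δ ⟶ 𝟭 A)
    (F K : A) (i : K ⟶ F) [Mono i]
    (hF : η.app (kernel (η.app F)) = 0) :
    η.app (kernel (η.app K)) = 0 := by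
  have w : η.app K ≫ i = δ.map i ≫ η.app F := (η.naturality i).symm
  let j : kernel (η.app K) ⟶ kernel (η.app F) :=
    kernel.map (η.app K) (η.app F) (δ.map i) i w
  have hj : j ≫ kernel.ι (η.app F) = kernel.ι (η.app K) ≫ δ.map i := kernel.lift_ι _ _ _
  have : Mono (j ≫ kernel.ι (η.app F)) := by
    rw [hj]
    exact mono_comp _ _
  have : Mono j := mono_of_mono j (kernel.ι (η.app F))
  have n : δ.map j ≫ η.app (kernel (η.app F)) = η.app (kernel (η.app K)) ≫ j := η.naturality j
  rw [hF, comp_zero] at n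
  exact zero_of_comp_mono j n.symm
end

section
/- Let k be a field and F : gr^op → Vect_k a functor. Then F is an outer functor (i.e., for every n, every inner automorphism of the free group F_n acts as the identity on F(F_n)) if and only if for every n ∈ ℕ one has F(c_n) = F(ι_n) as linear maps F(F_{n+1}) → F(F_n), where ι_n : F_n → F_{n+1} is the inclusion x_i ↦ x_i and c_n : F_n → F_{n+1} is the homomorphism x_i ↦ x_{n+1}^{-1} x_i x_{n+1}. (Equivalently, F is outer if and only if the natural transformation ρ̄_F : τ̄F → F vanishes, where τ is the shift (τF)(F_n) = F(F_{n+1}), τ̄F = ker F(ι), and ρ̄ is the restriction of the conjugation transformation ρ induced by the c_n.) -/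
open CategoryTheory

universe v

/-- The category `gr` of finitely generated free groups: a skeleton with objects the
natural numbers, where `n` stands for the free group `F_n = FreeGroup (Fin n)` and
morphisms are group homomorphisms. -/
structure Gr where
  /-- the rank of the free group -/
  r : ℕ

instance : Category Gr where
  Hom m n := FreeGroup (Fin m.r) →* FreeGroup (Fin n.r)
  id _ := MonoidHom.id _
  comp f g := g.comp f

/-- The inclusion `ι_n : F_n → F_{n+1}`, `x_i ↦ x_i`. -/
def iotaHom (n : ℕ) : Gr.mk n ⟶ Gr.mk (n + 1) :=
  FreeGroup.lift fun i => FreeGroup.of i.castSucc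

/-- The homomorphism `c_n : F_n → F_{n+1}`, `x_i ↦ x_{n+1}⁻¹ x_i x_{n+1}`. -/
def conjLastHom (n : ℕ) : Gr.mk n ⟶ Gr.mk (n + 1) :=
  FreeGroup.lift fun i =>
    (FreeGroup.of (Fin.last n))⁻¹ * FreeGroup.of i.castSucc * FreeGroup.of (Fin.last n)

/-- The inner automorphism of `F_n` given by conjugation by `g`: `x ↦ g⁻¹ x g`,
as an endomorphism of `F_n` in `gr`. -/
def innerHom (n : ℕ) (g : FreeGroup (Fin n)) : Gr.mk n ⟶ Gr.mk n :=
  (MulAut.conj g⁻¹).toMonoidHom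

/-- A functor `F : gr^op → Vect_k` is outer if every inner automorphism of `F_n` acts as
the identity on `F(F_n)`. -/
def IsOuter {k : Type v} [Field k] (F : Grᵒᵖ ⥤ ModuleCat.{v} k) : Prop :=
  ∀ (n : ℕ) (g : FreeGroup (Fin n)), F.map (innerHom n g).op = 𝟙 _

/-- `c_n = ι_n ≫ (conjugation by x_{n+1})`. -/
theorem conjLastHom_eq (n : ℕ) :
    conjLastHom n = iotaHom n ≫ innerHom (n + 1) (FreeGroup.of (Fin.last n)) := by
  change FreeGroup.lift _ =
    (MulAut.conj (FreeGroup.of (Fin.last n))⁻¹).toMonoidHom.comp (FreeGroup.lift _)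
  ext i
  simp

/-- The retraction `F_{n+1} → F_n` sending `x_i ↦ x_i` and `x_{n+1} ↦ g`. -/
def retrHom (n : ℕ) (g : FreeGroup (Fin n)) : Gr.mk (n + 1) ⟶ Gr.mk n :=
  FreeGroup.lift (Fin.snoc (α := fun _ => FreeGroup (Fin n)) FreeGroup.of g)

theorem iota_retr (n : ℕ) (g : FreeGroup (Fin n)) :
    iotaHom n ≫ retrHom n g = 𝟙 (Gr.mk n) := by
  change (FreeGroup.lift _).comp (FreeGroup.lift _) = MonoidHom.id _
  ext i
  simp

theorem conjLast_retr (n : ℕ) (g : FreeGroup (Fin n)) :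
    conjLastHom n ≫ retrHom n g = innerHom n g := by
  change (FreeGroup.lift _).comp (FreeGroup.lift _) = (MulAut.conj g⁻¹).toMonoidHom
  ext i
  simp

/-- A functor `F : gr^op → Vect_k` is outer if and only if for every `n` one has
`F(c_n) = F(ι_n)` as linear maps `F(F_{n+1}) → F(F_n)`, where `ι_n` is the inclusion and
`c_n : x_i ↦ x_{n+1}⁻¹ x_i x_{n+1}`. -/
theorem isOuter_iff_map_conjLast_eq_map_iota
    {k : Type v} [Field k] (F : Grᵒᵖ ⥤ ModuleCat.{v} k) :
    IsOuter F ↔ ∀ n : ℕ, F.map (conjLastHom n).op = F.map (iotaHom n).op := by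
  constructor
  · intro h n
    rw [conjLastHom_eq, op_comp, F.map_comp, h]
    exact Category.id_comp _
  · intro h n g
    rw [← conjLast_retr, op_comp, F.map_comp, h, ← F.map_comp, ← op_comp, iota_retr, op_id,
      F.map_id]
end

section
/- Let k be a field, F : gr^op → Vect_k a functor, and n ∈ ℕ, k ≥ 1. Let Ψ_{n,k} : F_{n+1} → F_{n+k} be the homomorphism with x_i ↦ x_i for i ≤ n and x_{n+1} ↦ x_{n+1} x_{n+2} ⋯ x_{n+k}, and for 1 ≤ i ≤ k let s_{n,i} : F_{n+k−1} → F_{n+k} be the injective homomorphism with x_j ↦ x_j for j ≤ n+i−1 and x_j ↦ x_{j+1} for j ≥ n+i (omitting the generator x_{n+i}). Then F(Ψ_{n,k}) maps the subspace ⋂_{i=1}^{k} ker( F(s_{n,i}) : F(F_{n+k}) → F(F_{n+k−1}) ) into ker( F(ι_n) : F(F_{n+1}) → F(F_n) ), where ι_n : F_n → F_{n+1} is the inclusion x_i ↦ x_i. (That is, the natural transformation ψ_k^* : τ^k → τ induced by ψ_k : F_1 → F_k, x ↦ x_1⋯x_k, restricts to a natural transformation τ̄^k → τ̄.) -/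
open CategoryTheory

universe v

/-- `Ψ_{n,k+1} : F_{n+1} → F_{n+k+1}`: `x_i ↦ x_i` for `i ≤ n` and the last generator is
sent to the product of the last `k+1` generators `x_{n+1} ⋯ x_{n+k+1}`. -/
def psiHom (n k : ℕ) : Gr.mk (n + 1) ⟶ Gr.mk (n + k + 1) :=
  FreeGroup.lift fun i : Fin (n + 1) =>
    if h : (i : ℕ) < n then FreeGroup.of (⟨(i : ℕ), by omega⟩ : Fin (n + k + 1))
    else (List.ofFn fun j : Fin (k + 1) =>
      FreeGroup.of (⟨n + (j : ℕ), by omega⟩ : Fin (n + k + 1))).prod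

/-- `s_{n,i} : F_{n+k} → F_{n+k+1}` (for `i` among the last `k+1` generators): the
injective homomorphism omitting the generator `x_{n+i+1}` (0-indexed pivot `n + i`). -/
def skipHom (n k : ℕ) (i : Fin (k + 1)) : Gr.mk (n + k) ⟶ Gr.mk (n + k + 1) :=
  FreeGroup.lift fun j : Fin (n + k) =>
    FreeGroup.of ((⟨n + (i : ℕ), by omega⟩ : Fin (n + k + 1)).succAbove j)

/-- For `F : gr^op → Vect_k` and `k+1 ≥ 1`, the map `F(Ψ_{n,k+1})` sends
`⋂ᵢ ker F(s_{n,i})` into `ker F(ι_n)`; i.e. the natural transformation `ψ^*` induced by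
`x ↦ x_1 ⋯ x_{k+1}` restricts to a natural transformation `τ̄^{k+1} → τ̄`. -/
theorem psi_maps_iterated_reduced_shift_into_reduced_shift
    {𝕜 : Type v} [Field 𝕜] (F : Grᵒᵖ ⥤ ModuleCat.{v} 𝕜) (n k : ℕ)
    (v : F.obj (Opposite.op (Gr.mk (n + k + 1))))
    (hv : ∀ i : Fin (k + 1), F.map (skipHom n k i).op v = 0) :
    F.map (iotaHom n).op (F.map (psiHom n k).op v) = 0 := by
  let j : Gr.mk n ⟶ Gr.mk (n + k) :=
    (FreeGroup.lift fun i : Fin n => FreeGroup.of (Fin.castAdd k i) :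
      FreeGroup (Fin n) →* FreeGroup (Fin (n + k)))
  have key : iotaHom n ≫ psiHom n k = j ≫ skipHom n k 0 := by
    apply FreeGroup.ext_hom
    intro i
    let a : FreeGroup (Fin n) →* FreeGroup (Fin (n + 1)) := iotaHom n
    let b : FreeGroup (Fin (n + 1)) →* FreeGroup (Fin (n + k + 1)) := psiHom n k
    let c : FreeGroup (Fin n) →* FreeGroup (Fin (n + k)) := j
    let d : FreeGroup (Fin (n + k)) →* FreeGroup (Fin (n + k + 1)) := skipHom n k 0
    change b (a (FreeGroup.of i)) = d (c (FreeGroup.of i))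
    have h1 : a (FreeGroup.of i) = FreeGroup.of i.castSucc := FreeGroup.lift_apply_of
    have h2 : c (FreeGroup.of i) = FreeGroup.of (Fin.castAdd k i) := FreeGroup.lift_apply_of
    rw [h1, h2]
    refine (FreeGroup.lift_apply_of).trans (Eq.trans ?_ (FreeGroup.lift_apply_of).symm)
    have hi : ((i.castSucc : Fin (n + 1)) : ℕ) < n := i.2
    rw [dif_pos hi, Fin.succAbove_of_castSucc_lt]
    · rfl
    · exact Fin.lt_def.mpr i.2
  have h3 : F.map (iotaHom n).op (F.map (psiHom n k).op v)
      = F.map (iotaHom n ≫ psiHom n k).op v := by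
    rw [op_comp, F.map_comp]; rfl
  have h4 : F.map (j ≫ skipHom n k 0).op v = F.map j.op (F.map (skipHom n k 0).op v) := by
    rw [op_comp, F.map_comp]; rfl
  rw [h3, key, h4, hv 0, map_zero]
end
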